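/- Let G < GL(V) be finite with the direct summand property, and U ⊆ V^G of codimension s. If the relative Hilbert ideal h_U (the ideal of k[V] generated by all invariants lying in the ideal U^⊥·k[V]) is generated by s homogeneous invariants, then the Hilbert ideal h = k[V]·k[V]^G_+ is generated by n homogeneous invariants (a complete intersection ideal). -/

import Mathlib

open MvPolynomial

set_option synthInstance.maxHeartbeats 1000000
set_option maxHeartbeats 1000000

variable {k : Type*} [Field k] {ι : Type*} [Fintype ι] [DecidableEq ι]

noncomputable def galAct (M : Matrix.GeneralLinearGroup ι k) :
    MvPolynomial ι k →ₐ[k] MvPolynomial ι k :=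
  aeval fun i => ∑ j, (((M⁻¹ : Matrix.GeneralLinearGroup ι k) : Matrix ι ι k) i j) • X j

def invariants (G : Subgroup (Matrix.GeneralLinearGroup ι k)) :
    Subalgebra k (MvPolynomial ι k) where
  carrier := {p | ∀ σ ∈ G, galAct σ p = p}
  mul_mem' := fun ha hb σ hσ => by rw [map_mul, ha σ hσ, hb σ hσ]
  add_mem' := fun ha hb σ hσ => by rw [map_add, ha σ hσ, hb σ hσ]
  algebraMap_mem' := fun r σ hσ => by simp [galAct]

noncomputable def fixedSpace (M : Matrix.GeneralLinearGroup ι k) : Submodule k (ι → k) :=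
  LinearMap.ker (Matrix.mulVecLin ((M : Matrix ι ι k) - 1))

noncomputable def moveSpace (M : Matrix.GeneralLinearGroup ι k) : Submodule k (ι → k) :=
  LinearMap.range (Matrix.mulVecLin ((M : Matrix ι ι k) - 1))

def IsPseudoReflection (M : Matrix.GeneralLinearGroup ι k) : Prop :=
  Module.finrank k (moveSpace M) = 1

def IsTransvection (M : Matrix.GeneralLinearGroup ι k) : Prop :=
  IsPseudoReflection M ∧ moveSpace M ≤ fixedSpace M

noncomputable def linForm (y : Module.Dual k (ι → k)) : MvPolynomial ι k :=
  ∑ i, C (y (Pi.single i 1)) * X i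

noncomputable def hilbertIdeal (G : Subgroup (Matrix.GeneralLinearGroup ι k)) :
    Ideal (MvPolynomial ι k) :=
  Ideal.span {p | p ∈ invariants G ∧ ∃ d, 0 < d ∧ p.IsHomogeneous d}

def DSP (G : Subgroup (Matrix.GeneralLinearGroup ι k)) : Prop :=
  ∃ π : MvPolynomial ι k →ₗ[↥(invariants G)] ↥(invariants G),
    Function.Surjective π ∧
    ∀ (p : MvPolynomial ι k) (d : ℕ), p.IsHomogeneous d →
      ((π p : MvPolynomial ι k)).IsHomogeneous d

noncomputable def fixedSubmodule (G : Subgroup (Matrix.GeneralLinearGroup ι k)) :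
    Submodule k (ι → k) := ⨅ σ ∈ G, fixedSpace σ

/-- The `k`-algebra map `k[X] → k[X][T]` translating the variable `X j` by `T`. -/
noncomputable def shiftVar {σ : Type*} [DecidableEq σ] (j : σ) :
    MvPolynomial σ k →ₐ[k] Polynomial (MvPolynomial σ k) :=
  aeval fun l => Polynomial.C (X l) + if l = j then Polynomial.X else 0

/-- The coefficient of `T ^ c` in `shiftVar j b` is the `c`-th Hasse derivative of `b` in the
variable `X j`. -/
lemma coeff_coeff_shiftVar {σ : Type*} [DecidableEq σ] (j : σ) (b : MvPolynomial σ k) :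
    ∀ (c : ℕ) (d : σ →₀ ℕ), coeff d ((shiftVar j b).coeff c) =
      ((d j + c).choose c : k) * coeff (d + Finsupp.single j c) b := by
  induction b using MvPolynomial.induction_on with
  | C r =>
    intro c d
    have h : shiftVar j (C r) = Polynomial.C (C r : MvPolynomial σ k) := by
      rw [shiftVar, ← MvPolynomial.algebraMap_eq, AlgHom.commutes]; rfl
    rw [h, Polynomial.coeff_C]
    rcases Nat.eq_zero_or_pos c with rfl | hc
    · simp
    · have : (0 : σ →₀ ℕ) ≠ d + Finsupp.single j c := by
        intro h0
        have := DFunLike.congr_fun h0 j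
        simp at this
        omega
      rw [if_neg hc.ne', coeff_C, if_neg this]
      simp
  | add p q hp hq =>
    intro c d
    simp [hp, hq, mul_add]
  | mul_X p l hp =>
    intro c d
    have h : shiftVar j (X l : MvPolynomial σ k) =
        Polynomial.C (X l) + if l = j then Polynomial.X else 0 := by
      simp [shiftVar]
    rw [map_mul, h]
    by_cases hl : l = j
    · subst hl
      rw [if_pos rfl, mul_add, Polynomial.coeff_add, Polynomial.coeff_mul_C, coeff_add,
        coeff_mul_X']
      cases c with
      | zero =>
        rw [Polynomial.coeff_mul_X_zero]
        simp [coeff_mul_X', hp]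
      | succ c =>
        rw [Polynomial.coeff_mul_X, hp, hp, coeff_mul_X']
        have h1 : d + Finsupp.single l (c + 1) - Finsupp.single l 1 = d + Finsupp.single l c := by
          ext i; by_cases hi : i = l
          · subst hi; simp
          · simp [Ne.symm hi]
        rw [h1, if_pos (show l ∈ (d + Finsupp.single l (c + 1)).support by simp)]
        by_cases hd : d l = 0
        · simp [hd]
        · rw [if_pos (by simp [hd])]
          have h2 : d - Finsupp.single l 1 + Finsupp.single l (c + 1)
              = d + Finsupp.single l c := by
            ext i; by_cases hi : i = l
            · subst hi; simp; omega
            · simp [Ne.symm hi]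
          obtain ⟨e, he⟩ : ∃ e, d l = e + 1 := ⟨d l - 1, by omega⟩
          rw [h2]
          have h3 : (d - Finsupp.single l 1 : σ →₀ ℕ) l = e := by simp [he]
          rw [h3, he, ← add_mul]
          congr 1
          rw [show e + 1 + (c + 1) = (e + 1 + c) + 1 by ring, Nat.choose_succ_succ,
            show e + 1 + c = e + (c + 1) by ring]
          push_cast; ring
    · rw [if_neg hl, add_zero, Polynomial.coeff_mul_C, coeff_mul_X', coeff_mul_X', hp]
      have hs : (l ∈ (d + Finsupp.single j c).support) ↔ l ∈ d.support := by
        simp [Ne.symm hl]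
      by_cases hd : l ∈ d.support
      · rw [if_pos hd, if_pos (hs.2 hd)]
        have h1 : d + Finsupp.single j c - Finsupp.single l 1 =
            d - Finsupp.single l 1 + Finsupp.single j c := by
          ext i; by_cases hi : i = l
          · subst hi; simp [Ne.symm hl]
          · simp [Ne.symm hi]
        rw [h1]
        simp [hl]
      · rw [if_neg hd, if_neg (fun h => hd (hs.1 h)), mul_zero]

lemma degree_coeff_shiftVar {σ : Type*} [DecidableEq σ] (m : MonomialOrder σ) (j : σ) {c : ℕ}
    {b : MvPolynomial σ k} (hc : c ≤ m.degree b j) (hch : ((m.degree b j).choose c : k) ≠ 0)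
    (hb : b ≠ 0) : (shiftVar j b).coeff c ≠ 0 ∧
      m.degree ((shiftVar j b).coeff c) = m.degree b - Finsupp.single j c := by
  have h1 : m.degree b - Finsupp.single j c + Finsupp.single j c = m.degree b :=
    tsub_add_cancel_of_le (by
      intro i; by_cases hi : i = j
      · subst hi; simpa using hc
      · simp [Ne.symm hi])
  have h2 : coeff (m.degree b - Finsupp.single j c) ((shiftVar j b).coeff c) ≠ 0 := by
    rw [coeff_coeff_shiftVar, h1]
    have : (m.degree b - Finsupp.single j c) j + c = m.degree b j := by
      simp; omega
    rw [this]
    exact mul_ne_zero hch (m.coeff_degree_ne_zero_iff.2 hb)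
  refine ⟨fun h => h2 (by simp [h]), ?_⟩
  apply m.toSyn.injective
  apply le_antisymm
  · rw [m.degree_le_iff]
    intro d hd
    rw [mem_support_iff, coeff_coeff_shiftVar] at hd
    have h3 := m.le_degree (mem_support_iff.2 (right_ne_zero_of_mul hd))
    rw [← h1, map_add, map_add] at h3
    exact le_of_add_le_add_right h3
  · exact m.le_degree (mem_support_iff.2 h2)

lemma dvd_of_choose_closed (k : Type*) [Field k] {D : Set ℕ}
    (hD : ∀ d ∈ D, ∀ c ≤ d, (d.choose c : k) ≠ 0 → c ∈ D)
    {q : ℕ} (hq : q ∈ D) (hq0 : 0 < q) (hmin : ∀ d ∈ D, 0 < d → q ≤ d) :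
    ∀ d ∈ D, q ∣ d := by
  obtain ⟨p, hp⟩ := ExpChar.exists k
  cases hp with
  | zero =>
    have : 1 ∈ D := hD q hq 1 hq0 (by simpa using hq0.ne')
    have := hmin 1 this one_pos
    have : q = 1 := by omega
    simp [this]
  | prime hp =>
    have := Fact.mk hp
    have key : ∀ d ∈ D, 0 < d → ∃ i t, d = p ^ i * t ∧ p ^ i ∈ D := by
      intro d hd hd0
      obtain ⟨i, t, ht, rfl⟩ := Nat.exists_eq_pow_mul_and_not_dvd hd0.ne' p hp.ne_one
      refine ⟨i, t, rfl, hD _ hd _ (Nat.le_of_dvd hd0 (dvd_mul_right _ _)) ?_⟩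
      have h := Choose.choose_pow_mul_pow_mul_modEq_choose_nat (p := p) (k := i) (a := t) (b := 1)
      rw [mul_one, Nat.choose_one_right] at h
      rw [Ne, CharP.cast_eq_zero_iff k p, (h.dvd_iff dvd_rfl)]
      exact ht
    obtain ⟨i, t, hit, hi⟩ := key q hq hq0
    have hqi : q = p ^ i := by
      apply le_antisymm (hmin _ hi (pow_pos hp.pos _))
      exact Nat.le_of_dvd hq0 ⟨t, hit⟩
    intro d hd
    rcases Nat.eq_zero_or_pos d with rfl | hd0
    · exact dvd_zero _
    obtain ⟨i₁, t₁, rfl, hi₁⟩ := key d hd hd0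
    have := hmin _ hi₁ (pow_pos hp.pos _)
    rw [hqi] at this ⊢
    exact dvd_mul_of_dvd_left (pow_dvd_pow _ ((Nat.pow_le_pow_iff_right hp.one_lt).1 this)) _

/-- A graded subalgebra of a polynomial ring that is stable under partial Hasse derivatives and
contains a power of each variable has an augmentation ideal generated by as many homogeneous
elements as there are variables. -/
lemma exists_generators_of_hasse_stable {σ : Type*} [Fintype σ] [DecidableEq σ]
    (m : MonomialOrder σ) (B : Subalgebra k (MvPolynomial σ k))
    (hhasse : ∀ b ∈ B, ∀ j c, (shiftVar j b).coeff c ∈ B)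
    (hpow : ∀ j, ∃ N, 0 < N ∧ (X j) ^ N ∈ B)
    (hhom : ∀ b ∈ B, ∀ d, homogeneousComponent d b ∈ B) :
    ∃ g : σ → MvPolynomial σ k, (∀ j, g j ∈ B ∧ ∃ d, 0 < d ∧ (g j).IsHomogeneous d) ∧
      ∀ b ∈ B, ∃ (c : k) (h : σ → MvPolynomial σ k), (∀ j, h j ∈ B) ∧
        b = C c + ∑ j, h j * g j := by
  classical
  let L : Set (σ →₀ ℕ) := {a | ∃ b ∈ B, b ≠ 0 ∧ m.degree b = a}
  have hL : ∀ a ∈ L, ∀ j, ∀ c ≤ a j, ((a j).choose c : k) ≠ 0 → a - Finsupp.single j c ∈ L := by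
    rintro _ ⟨b, hb, hb0, rfl⟩ j c hc hch
    have := degree_coeff_shiftVar m j hc hch hb0
    exact ⟨_, hhasse b hb j c, this⟩
  have herase : ∀ (s : Finset σ), ∀ a ∈ L, a.filter (· ∉ s) ∈ L := by
    intro s
    induction s using Finset.induction_on with
    | empty => intro a ha; rwa [Finsupp.filter_eq_self_iff _ _ |>.2 (by simp)]
    | insert j s hj ih =>
      intro a ha
      have := hL _ (ih a ha) j (a j) (by simp [hj]) (by simp [hj])
      convert this using 1
      ext i
      by_cases hi : i = j
      · subst hi; simp [hj]
      · simp [Finsupp.filter_apply, hi]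
  have hsingle : ∀ a ∈ L, ∀ j, Finsupp.single j (a j) ∈ L := by
    intro a ha j
    convert herase (Finset.univ.erase j) a ha using 1
    ext i
    by_cases hi : i = j
    · subst hi; simp
    · simp [hi]
  have hD : ∀ j, ∀ d ∈ {d | Finsupp.single j d ∈ L}, ∀ c ≤ d, (d.choose c : k) ≠ 0 →
      c ∈ {d | Finsupp.single j d ∈ L} := by
    intro j d hd c hc hch
    have := hL _ hd j (d - c) (by simp) (by simpa [Nat.choose_symm hc] using hch)
    rw [← Finsupp.single_tsub, Nat.sub_sub_self hc] at this
    exact this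
  have hex : ∀ j, ∃ d, 0 < d ∧ Finsupp.single j d ∈ L := by
    intro j
    obtain ⟨N, hN, hX⟩ := hpow j
    refine ⟨N, hN, _, hX, pow_ne_zero _ (X_ne_zero j), ?_⟩
    rw [m.degree_pow, m.degree_X]; simp
  let q : σ → ℕ := fun j => Nat.find (hex j)
  have hq0 : ∀ j, 0 < q j := fun j => (Nat.find_spec (hex j)).1
  have hqL : ∀ j, Finsupp.single j (q j) ∈ L := fun j => (Nat.find_spec (hex j)).2
  have hdvd : ∀ a ∈ L, ∀ j, q j ∣ a j := fun a ha j =>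
    dvd_of_choose_closed k (hD j) (hqL j) (hq0 j)
      (fun d hd hd0 => Nat.find_min' (hex j) ⟨hd0, hd⟩) _ (hsingle a ha j)
  have hg : ∀ j, ∃ g ∈ B, g ≠ 0 ∧ m.degree g = Finsupp.single j (q j) ∧
      g.IsHomogeneous (q j) := by
    intro j
    obtain ⟨b, hb, hb0, hdeg⟩ := hqL j
    have h1 : coeff (Finsupp.single j (q j)) (homogeneousComponent (q j) b) ≠ 0 := by
      rw [coeff_homogeneousComponent, if_pos (by simp), ← hdeg]
      exact m.coeff_degree_ne_zero_iff.2 hb0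
    refine ⟨homogeneousComponent (q j) b, hhom b hb _, fun h => h1 (by simp [h]), ?_,
      homogeneousComponent_isHomogeneous _ _⟩
    apply m.toSyn.injective
    apply le_antisymm
    · rw [← hdeg]
      apply m.degree_le_degree_of_support_subset
      rw [support_homogeneousComponent]
      exact Finset.filter_subset _ _
    · exact m.le_degree (mem_support_iff.2 h1)
  choose g hgB hg0 hgdeg hghom using hg
  refine ⟨g, fun j => ⟨hgB j, q j, hq0 j, hghom j⟩, ?_⟩
  suffices H : ∀ (s : m.syn), ∀ b ∈ B, m.toSyn (m.degree b) = s →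
      ∃ (c : k) (h : σ → MvPolynomial σ k), (∀ j, h j ∈ B) ∧ b = C c + ∑ j, h j * g j from
    fun b hb => H _ b hb rfl
  intro s
  induction s using WellFoundedLT.induction with
  | ind s ih =>
  rintro b hb rfl
  by_cases hdeg0 : m.degree b = 0
  · exact ⟨m.leadingCoeff b, 0, fun j => B.zero_mem, by
      simpa using m.eq_C_of_degree_eq_zero hdeg0⟩
  have hb0 := m.ne_zero_of_degree_ne_zero hdeg0
  have hbL : m.degree b ∈ L := ⟨b, hb, hb0, rfl⟩
  obtain ⟨j, hj⟩ : ∃ j, m.degree b j ≠ 0 := by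
    by_contra! h; exact hdeg0 (Finsupp.ext h)
  choose t ht using hdvd _ hbL
  let P : MvPolynomial σ k := ∏ i, g i ^ t i
  have hP0 : P ≠ 0 := Finset.prod_ne_zero_iff.2 fun i _ => pow_ne_zero _ (hg0 i)
  have hPdeg : m.degree P = m.degree b := by
    rw [m.degree_prod (fun i _ => pow_ne_zero _ (hg0 i))]
    ext i
    simp [m.degree_pow, hgdeg, Finsupp.single_apply, ht i, mul_comm]
  let r : k := m.leadingCoeff b / m.leadingCoeff P
  have hPl : m.leadingCoeff P ≠ 0 := m.leadingCoeff_ne_zero_iff.2 hP0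
  have htj : t j ≠ 0 := fun h => hj (by rw [ht j, h, mul_zero])
  let Q : MvPolynomial σ k := g j ^ (t j - 1) * ∏ i ∈ Finset.univ.erase j, g i ^ t i
  have hPQ : P = Q * g j := by
    have := Finset.mul_prod_erase Finset.univ (fun i => g i ^ t i) (Finset.mem_univ j)
    change ∏ i, g i ^ t i = _
    rw [← this, ← mul_pow_sub_one htj]
    ring
  have hQB : Q ∈ B := B.mul_mem (B.pow_mem (hgB j) _) (B.prod_mem fun i _ => B.pow_mem (hgB i) _)
  have hlt : m.toSyn (m.degree (b - C r * P)) < m.toSyn (m.degree b) := by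
    rw [m.degree_lt_iff]
    · intro d hd
      refine lt_of_le_of_ne ?_ ?_
      · by_contra! hlt
        have h1 := m.coeff_eq_zero_of_lt hlt
        have h2 := m.coeff_eq_zero_of_lt (f := P) (by rw [hPdeg]; exact hlt)
        rw [mem_support_iff] at hd
        simp [h1, h2] at hd
      · intro h
        have := m.toSyn.injective h
        subst this
        rw [mem_support_iff, coeff_sub, coeff_C_mul] at hd
        apply hd
        have h1 : coeff (m.degree b) P = m.leadingCoeff P := by rw [← hPdeg]; rfl
        rw [h1, div_mul_cancel₀ _ hPl]
        exact sub_self _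
    · rw [map_zero]; exact m.toSyn_lt_iff_ne_zero.2 (by simpa using hdeg0)
  have hPB : C r * P ∈ B := by
    rw [hPQ, ← MvPolynomial.algebraMap_eq]
    exact B.mul_mem (B.algebraMap_mem r) (B.mul_mem hQB (hgB j))
  obtain ⟨c, h, hhB, hbe⟩ := ih _ hlt (b - C r * P) (B.sub_mem hb hPB) rfl
  refine ⟨c, h + Pi.single j (C r * Q), fun i => ?_, ?_⟩
  · refine B.add_mem (hhB i) ?_
    by_cases hi : i = j
    · subst hi
      rw [Pi.single_eq_same, ← MvPolynomial.algebraMap_eq]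
      exact B.mul_mem (B.algebraMap_mem r) hQB
    · rw [Pi.single_eq_of_ne hi]; exact B.zero_mem
  · have hs : ∑ i, (Pi.single j (C r * Q) : σ → MvPolynomial σ k) i * g i = C r * P := by
      rw [Finset.sum_eq_single j (fun i _ hi => by rw [Pi.single_eq_of_ne hi, zero_mul])
        (fun h => absurd (Finset.mem_univ j) h), Pi.single_eq_same, hPQ, mul_assoc]
    simp only [Pi.add_apply, add_mul, Finset.sum_add_distrib, hs]
    rw [← add_assoc, ← hbe, sub_add_cancel]

lemma map_homogeneousComponent_of_linear {σ τ : Type*}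
    (φ : MvPolynomial σ k →ₐ[k] MvPolynomial τ k) (hφ : ∀ i, (φ (X i)).IsHomogeneous 1)
    (d : ℕ) (p : MvPolynomial σ k) :
    φ (homogeneousComponent d p) = homogeneousComponent d (φ p) := by
  have h : ∀ e, (φ (homogeneousComponent e p)).IsHomogeneous e := by
    intro e
    rw [aeval_unique φ]
    simpa only [one_mul] using! (homogeneousComponent_isHomogeneous e p).aeval _ hφ
  conv_rhs => rw [← sum_homogeneousComponent p, map_sum, map_sum]
  have h2 : ∀ e, homogeneousComponent d (φ (homogeneousComponent e p)) =
      if e = d then φ (homogeneousComponent e p) else 0 := fun e => by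
    rw [homogeneousComponent_of_mem (h e)]; simp [eq_comm]
  simp_rw [h2]
  rw [Finset.sum_ite_eq']
  split_ifs with hd
  · rfl
  · rw [homogeneousComponent_eq_zero _ _ (by simpa using hd), map_zero]

lemma galAct_X (M : Matrix.GeneralLinearGroup ι k) (i : ι) :
    galAct M (X i) =
      ∑ j, (((M⁻¹ : Matrix.GeneralLinearGroup ι k) : Matrix ι ι k) i j) • X j := by
  simp [galAct]

lemma galAct_mul (M N : Matrix.GeneralLinearGroup ι k) (p : MvPolynomial ι k) :
    galAct (M * N) p = galAct M (galAct N p) := by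
  suffices h : galAct (M * N) = (galAct M).comp (galAct N) by rw [h]; rfl
  ext1 i
  simp only [AlgHom.comp_apply, galAct_X, map_sum, map_smul, mul_inv_rev, Units.val_mul,
    Matrix.mul_apply, Finset.sum_smul, Finset.smul_sum, smul_smul]
  exact Finset.sum_comm

lemma homogeneousComponent_mem_invariants {G : Subgroup (Matrix.GeneralLinearGroup ι k)}
    {p : MvPolynomial ι k} (hp : p ∈ invariants G) (d : ℕ) :
    homogeneousComponent d p ∈ invariants G := by
  intro σ hσ
  rw [map_homogeneousComponent_of_linear, hp σ hσ]
  intro i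
  rw [galAct_X]
  exact IsHomogeneous.sum _ _ _ fun j _ => by
    rw [smul_eq_C_mul]; exact (isHomogeneous_X k j).C_mul _

lemma prod_galAct_mem_invariants (G : Subgroup (Matrix.GeneralLinearGroup ι k)) [Fintype G]
    (p : MvPolynomial ι k) : ∏ σ : G, galAct (σ : Matrix.GeneralLinearGroup ι k) p
      ∈ invariants G := by
  intro τ hτ
  rw [map_prod]
  simp_rw [← galAct_mul]
  exact Fintype.prod_equiv (Equiv.mulLeft (⟨τ, hτ⟩ : G)) _ _ fun σ => rfl

lemma inv_mulVec_of_mem_fixedSubmodule {G : Subgroup (Matrix.GeneralLinearGroup ι k)}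
    {u : ι → k} (hu : u ∈ fixedSubmodule G) {σ : Matrix.GeneralLinearGroup ι k} (hσ : σ ∈ G)
    (i : ι) : ∑ j, ((σ⁻¹ : Matrix.GeneralLinearGroup ι k) : Matrix ι ι k) i j * u j = u i := by
  have h := (Submodule.mem_iInf _).1 ((Submodule.mem_iInf _).1 hu σ⁻¹) (G.inv_mem hσ)
  rw [fixedSpace, LinearMap.mem_ker, Matrix.mulVecLin_apply, Matrix.sub_mulVec,
    Matrix.one_mulVec, sub_eq_zero] at h
  exact congrFun h i

/-- The `k`-algebra map `k[X] → k[X][T]` given by translation along the line `T • u`. -/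
noncomputable def shiftAlong (u : ι → k) :
    MvPolynomial ι k →ₐ[k] Polynomial (MvPolynomial ι k) :=
  aeval fun i => Polynomial.C (X i) + Polynomial.C (C (u i)) * Polynomial.X

lemma coeff_shiftAlong_mem_invariants {G : Subgroup (Matrix.GeneralLinearGroup ι k)}
    {u : ι → k} (hu : u ∈ fixedSubmodule G) {p : MvPolynomial ι k} (hp : p ∈ invariants G)
    (c : ℕ) : (shiftAlong u p).coeff c ∈ invariants G := by
  intro σ hσ
  have h : (shiftAlong u).comp (galAct σ) =
      (Polynomial.mapAlgHom (galAct σ)).comp (shiftAlong u) := by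
    ext1 i
    have hi : (∑ j, Polynomial.C (C (((σ⁻¹ : Matrix.GeneralLinearGroup ι k) : Matrix ι ι k) i j
        * u j)) : Polynomial (MvPolynomial ι k)) = Polynomial.C (C (u i)) := by
      rw [← inv_mulVec_of_mem_fixedSubmodule hu hσ i, map_sum, map_sum]
    have hX : ∀ i, shiftAlong u (X i) =
      Polynomial.C (X i) + Polynomial.C (C (u i)) * Polynomial.X := fun i => by simp [shiftAlong]
    have hC : ∀ r, galAct σ (C r) = C r := fun r => by simp [galAct]
    simp only [AlgHom.comp_apply, Polynomial.coe_mapAlgHom, hX, Polynomial.map_add,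
      Polynomial.map_mul, Polynomial.map_C, Polynomial.map_X, RingHom.coe_coe, hC]
    rw [galAct_X, map_sum, map_sum, ← hi, Finset.sum_mul, ← Finset.sum_add_distrib]
    refine Finset.sum_congr rfl fun j _ => ?_
    rw [map_smul, hX, smul_add, smul_eq_C_mul, map_mul, map_mul, map_mul, Algebra.smul_def,
      Algebra.smul_def, mul_assoc]
    rfl
  have h2 := DFunLike.congr_fun h p
  rw [AlgHom.comp_apply, AlgHom.comp_apply, hp σ hσ] at h2
  conv_rhs => rw [h2]
  simp

/-- Restriction of polynomial functions to the span of the vectors `b j`, in the coordinates given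
by the `b j`. -/
noncomputable def restrict {κ : Type*} [Fintype κ] (b : κ → ι → k) :
    MvPolynomial ι k →ₐ[k] MvPolynomial κ k :=
  aeval fun i => ∑ j, C (b j i) * X j

lemma restrict_X {σ κ : Type*} [Fintype κ] (b : κ → σ → k) (i : σ) :
    restrict b (X i) = ∑ j, C (b j i) * X j := by
  simp [restrict]

lemma restrict_homogeneousComponent {σ κ : Type*} [Fintype κ] (b : κ → σ → k) (d : ℕ)
    (p : MvPolynomial σ k) :
    restrict b (homogeneousComponent d p) = homogeneousComponent d (restrict b p) := by
  apply map_homogeneousComponent_of_linear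
  intro i
  rw [restrict_X]
  exact IsHomogeneous.sum _ _ _ fun j _ => (isHomogeneous_X k j).C_mul _

lemma restrict_linForm {κ : Type*} [Fintype κ] (b : κ → ι → k) (y : Module.Dual k (ι → k)) :
    restrict b (linForm y) = ∑ j, C (y (b j)) * X j := by
  have hy : ∀ v, y v = ∑ i, v i * y (Pi.single i 1) := fun v => by
    conv_lhs => rw [pi_eq_sum_univ' v]
    simp
  have hC : ∀ r, restrict b (C r) = C r := fun r => by simp [restrict]
  simp only [linForm, map_sum, map_mul, restrict_X, Finset.mul_sum, hC]
  rw [Finset.sum_comm]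
  refine Finset.sum_congr rfl fun j _ => ?_
  rw [hy (b j), map_sum, Finset.sum_mul]
  refine Finset.sum_congr rfl fun i _ => ?_
  rw [map_mul]; ring

lemma restrict_galAct {κ : Type*} [Fintype κ] (b : κ → ι → k)
    {G : Subgroup (Matrix.GeneralLinearGroup ι k)}
    (hb : ∀ j, b j ∈ fixedSubmodule G) {σ : Matrix.GeneralLinearGroup ι k} (hσ : σ ∈ G)
    (p : MvPolynomial ι k) : restrict b (galAct σ p) = restrict b p := by
  suffices h : (restrict b).comp (galAct σ) = restrict b by
    conv_rhs => rw [← h]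
    rfl
  ext1 i
  rw [AlgHom.comp_apply, galAct_X, map_sum, restrict_X]
  simp only [map_smul, restrict_X, Finset.smul_sum]
  rw [Finset.sum_comm]
  refine Finset.sum_congr rfl fun j _ => ?_
  rw [← inv_mulVec_of_mem_fixedSubmodule (hb j) hσ i, map_sum, Finset.sum_mul]
  refine Finset.sum_congr rfl fun l _ => ?_
  rw [smul_eq_C_mul, map_mul, mul_assoc]

lemma map_restrict_shiftAlong {σ κ : Type*} [Fintype κ] [DecidableEq κ] (b : κ → σ → k) (j : κ)
    (p : MvPolynomial σ k) :
    (shiftAlong (b j) p).map (restrict b : MvPolynomial σ k →+* MvPolynomial κ k) =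
      shiftVar j (restrict b p) := by
  suffices h : (Polynomial.mapAlgHom (restrict b)).comp (shiftAlong (b j)) =
      (shiftVar j).comp (restrict b) from DFunLike.congr_fun h p
  ext1 i
  have hC : ∀ r, restrict b (C r) = C r := fun r => by simp [restrict]
  have hCvar : ∀ r, shiftVar j (C r : MvPolynomial κ k) = Polynomial.C (C r) := fun r => by
    rw [shiftVar, ← MvPolynomial.algebraMap_eq, AlgHom.commutes]; rfl
  have hX : ∀ l, shiftVar j (X l : MvPolynomial κ k) =
      Polynomial.C (X l) + if l = j then Polynomial.X else 0 := fun l => by simp [shiftVar]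
  have hXalong : shiftAlong (b j) (X i) =
      Polynomial.C (X i) + Polynomial.C (C (b j i)) * Polynomial.X := by simp [shiftAlong]
  simp only [AlgHom.comp_apply, Polynomial.coe_mapAlgHom, hXalong, Polynomial.map_add,
    Polynomial.map_mul, Polynomial.map_C, Polynomial.map_X, RingHom.coe_coe, hC, restrict_X,
    map_sum, map_mul, hCvar, hX, mul_add, Finset.sum_add_distrib, mul_ite, mul_zero,
    Finset.sum_ite_eq', Finset.mem_univ, if_true]

lemma mem_span_linForm_of_restrict_eq_zero {κ : Type*} [Fintype κ] [DecidableEq κ]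
    (b : κ → ι → k) {U : Submodule k (ι → k)}
    (hspan : Submodule.span k (Set.range b) = U) {y : κ → Module.Dual k (ι → k)}
    (hy : ∀ i j, y i (b j) = if i = j then 1 else 0) {p : MvPolynomial ι k}
    (hp : restrict b p = 0) :
    p ∈ Ideal.span (linForm '' (U.dualAnnihilator : Set (Module.Dual k (ι → k)))) := by
  set P := Ideal.span (linForm '' (U.dualAnnihilator : Set (Module.Dual k (ι → k))))
  let ψ : MvPolynomial κ k →ₐ[k] MvPolynomial ι k := aeval fun j => linForm (y j)
  have h : (Ideal.Quotient.mkₐ k P).comp (ψ.comp (restrict b)) = Ideal.Quotient.mkₐ k P := by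
    ext1 i
    simp only [AlgHom.comp_apply, Ideal.Quotient.mkₐ_eq_mk]
    rw [Ideal.Quotient.eq, ← neg_mem_iff, neg_sub]
    apply Ideal.subset_span
    refine ⟨LinearMap.proj i - ∑ j, b j i • y j, ?_, ?_⟩
    · rw [SetLike.mem_coe, Submodule.mem_dualAnnihilator, ← hspan]
      intro w hw
      induction hw using Submodule.span_induction with
      | mem x hx => obtain ⟨l, rfl⟩ := hx; simp [hy]
      | zero => simp
      | add v w _ _ hv hw => rw [map_add, hv, hw, add_zero]
      | smul r v _ hv => rw [map_smul, hv, smul_zero]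
    · have hX : (∑ l, C ((Pi.single l 1 : ι → k) i) * X l : MvPolynomial ι k) = X i := by
        rw [Finset.sum_eq_single i] <;> simp +contextual [eq_comm]
      have hψ : ψ (restrict b (X i)) = ∑ j, C (b j i) * linForm (y j) := by
        rw [restrict_X, map_sum]
        refine Finset.sum_congr rfl fun j _ => ?_
        simp [ψ]
      rw [hψ]
      conv_rhs => rw [← hX]
      simp only [linForm, LinearMap.sub_apply, LinearMap.proj_apply, LinearMap.sum_apply,
        LinearMap.smul_apply, map_sub, sub_mul, Finset.sum_sub_distrib, map_sum, Finset.sum_mul,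
        Finset.mul_sum, smul_eq_mul, map_mul, mul_assoc]
      rw [Finset.sum_comm (s := Finset.univ (α := κ))]
  have h2 := DFunLike.congr_fun h p
  simp only [AlgHom.comp_apply, hp, map_zero] at h2
  exact Ideal.Quotient.eq_zero_iff_mem.1 h2.symm

/-- The invariants restricted to a subspace of fixed vectors have an augmentation ideal generated
by as many homogeneous elements as the dimension of the subspace. -/
lemma exists_invariants_generating_restriction
    (G : Subgroup (Matrix.GeneralLinearGroup ι k)) [Finite G] {m : ℕ} {b : Fin m → ι → k}
    (hb : ∀ j, b j ∈ fixedSubmodule G) {y : Fin m → Module.Dual k (ι → k)}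
    (hy : ∀ i j, y i (b j) = if i = j then 1 else 0) :
    ∃ g : Fin m → MvPolynomial ι k, (∀ j, g j ∈ invariants G) ∧
      (∀ j, ∃ d, 0 < d ∧ (g j).IsHomogeneous d) ∧
      ∀ p ∈ invariants G, ∃ (c : k) (h : Fin m → MvPolynomial ι k), (∀ j, h j ∈ invariants G) ∧
        restrict b p = restrict b (C c + ∑ j, h j * g j) := by
  have := Fintype.ofFinite G
  obtain ⟨g, hg, hgen⟩ := exists_generators_of_hasse_stable MonomialOrder.lex
    ((invariants G).map (restrict b)) (by
      rintro _ ⟨p, hp, rfl⟩ j c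
      refine ⟨(shiftAlong (b j) p).coeff c, coeff_shiftAlong_mem_invariants (hb j) hp c, ?_⟩
      have := congrArg (fun q => q.coeff c) (map_restrict_shiftAlong b j p)
      simpa using this) (by
      intro j
      refine ⟨Fintype.card G, Fintype.card_pos, _, prod_galAct_mem_invariants G (linForm (y j)), ?_⟩
      change restrict b _ = _
      rw [map_prod, Finset.prod_congr rfl fun σ _ => restrict_galAct b hb σ.2 _, Finset.prod_const,
        Finset.card_univ, restrict_linForm]
      simp [hy]) (by
      rintro _ ⟨p, hp, rfl⟩ d
      exact ⟨_, homogeneousComponent_mem_invariants hp d, restrict_homogeneousComponent b d p⟩)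
  have hlift : ∀ j, ∃ q ∈ invariants G, (∃ d, 0 < d ∧ q.IsHomogeneous d) ∧ restrict b q = g j := by
    intro j
    obtain ⟨⟨q, hq, hqg⟩, d, hd, hdg⟩ := hg j
    refine ⟨homogeneousComponent d q, homogeneousComponent_mem_invariants hq d,
      ⟨d, hd, homogeneousComponent_isHomogeneous d q⟩, ?_⟩
    rw [restrict_homogeneousComponent]
    change homogeneousComponent d ((restrict b) q) = _
    rw [show restrict b q = g j from hqg, homogeneousComponent_eq_self hdg]
  choose q hq hqhom hqg using hlift
  refine ⟨q, hq, hqhom, fun p hp => ?_⟩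
  obtain ⟨c, h, hh, he⟩ := hgen (restrict b p) ⟨p, hp, rfl⟩
  choose r hrInv hhe using hh
  refine ⟨c, r, hrInv, ?_⟩
  have hC : restrict b (C c) = C c := by simp [restrict]
  rw [he, map_add, map_sum, hC]
  congr 1
  refine Finset.sum_congr rfl fun j _ => ?_
  rw [map_mul, hqg]
  congr 1
  exact (hhe j).symm

lemma constantCoeff_eq_zero_of_isHomogeneous {σ : Type*} {p : MvPolynomial σ k} {d : ℕ}
    (hp : p.IsHomogeneous d) (hd : 0 < d) : constantCoeff p = 0 := by
  rw [constantCoeff_eq]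
  exact hp.coeff_eq_zero (by simpa using hd.ne)

/-- Let `G < GL(V)` be finite with the direct summand property and
`U ⊆ V^G` of codimension `s`. If the relative Hilbert ideal `h_U` — the extension to `k[V]`
of the contraction to `k[V]^G` of the ideal `U^⊥·k[V]`, i.e. the ideal of `k[V]` generated
by all invariants lying in `U^⊥·k[V]` — is generated by `s` homogeneous invariants, then the
Hilbert ideal `h` is generated by `n` homogeneous invariants (a complete intersection). -/
theorem statement10 {k : Type*} [Field k] {n : ℕ}
    (G : Subgroup (Matrix.GeneralLinearGroup (Fin n) k)) [Finite ↥G]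
    (hdsp : DSP G)
    (U : Submodule k (Fin n → k)) (hU : U ≤ fixedSubmodule G)
    (f : Fin (n - Module.finrank k ↥U) → MvPolynomial (Fin n) k)
    (hfinv : ∀ i, f i ∈ invariants G)
    (hfhom : ∀ i, ∃ d, (f i).IsHomogeneous d)
    (hfgen : Ideal.span (Set.range f) =
      Ideal.map (algebraMap ↥(invariants G) (MvPolynomial (Fin n) k))
        (Ideal.comap (algebraMap ↥(invariants G) (MvPolynomial (Fin n) k))
          (Ideal.span (linForm '' (U.dualAnnihilator : Set (Module.Dual k (Fin n → k))))))) :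
    ∃ g : Fin n → MvPolynomial (Fin n) k,
      (∀ i, g i ∈ invariants G) ∧ (∀ i, ∃ d, (g i).IsHomogeneous d) ∧
      Ideal.span (Set.range g) = hilbertIdeal G := by
  classical
  set P := Ideal.span (linForm '' (U.dualAnnihilator : Set (Module.Dual k (Fin n → k)))) with hP
  let m := Module.finrank k U
  have hmn : m ≤ n := by simpa using U.finrank_le
  let B := Module.finBasis k U
  let b : Fin m → Fin n → k := fun j => B j
  have hspan : Submodule.span k (Set.range b) = U := by
    have h := congrArg (Submodule.map U.subtype) B.span_eq
    rwa [Submodule.map_span, ← Set.range_comp, Submodule.map_top, Submodule.range_subtype] at h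
  obtain ⟨π, hπ⟩ := U.subtype.exists_leftInverse_of_injective U.ker_subtype
  let y : Fin m → Module.Dual k (Fin n → k) := fun j => (B.coord j).comp π
  have hy : ∀ i j, y i (b j) = if i = j then 1 else 0 := by
    intro i j
    have : π (B j) = B j := DFunLike.congr_fun hπ (B j)
    simp [y, b, this, Finsupp.single_apply, eq_comm]
  obtain ⟨g, hginv, hghom, hggen⟩ := exists_invariants_generating_restriction G
    (fun j => hU (B j).2) hy
  have hP0 : ∀ p ∈ P, constantCoeff p = 0 := by
    intro p hp
    have : P ≤ RingHom.ker (constantCoeff : MvPolynomial (Fin n) k →+* k) := by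
      rw [hP, Ideal.span_le]
      rintro _ ⟨l, -, rfl⟩
      simp [linForm, RingHom.mem_ker]
    exact this hp
  have hfP : Ideal.span (Set.range f) ≤ P := hfgen.le.trans Ideal.map_comap_le
  let e : Fin n ≃ Fin (n - m) ⊕ Fin m :=
    (finCongr (Nat.sub_add_cancel hmn).symm).trans finSumFinEquiv.symm
  have hrange : Set.range (Sum.elim f g ∘ e) = Set.range f ∪ Set.range g := by
    rw [e.surjective.range_comp, Set.Sum.elim_range]
  have hinv : ∀ i, Sum.elim f g i ∈ invariants G := by
    rintro (i | j)
    · exact hfinv i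
    · exact hginv j
  have hhom : ∀ i, ∃ d, (Sum.elim f g i).IsHomogeneous d := by
    rintro (i | j)
    · exact hfhom i
    · exact (hghom j).imp fun _ h => h.2
  refine ⟨Sum.elim f g ∘ e, fun i => hinv _, fun i => hhom _, ?_⟩
  rw [hrange]
  apply le_antisymm
  · rw [Ideal.span_le, Set.union_subset_iff]
    constructor
    · rintro _ ⟨i, rfl⟩
      obtain ⟨d, hd⟩ := hfhom i
      rcases Nat.eq_zero_or_pos d with rfl | hd0
      · have h0 := hP0 _ (hfP (Ideal.subset_span ⟨i, rfl⟩))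
        have h1 := homogeneousComponent_eq_self hd
        rw [homogeneousComponent_zero, ← constantCoeff_eq, h0, map_zero] at h1
        rw [← h1]
        exact Ideal.zero_mem _
      · exact Ideal.subset_span ⟨hfinv i, d, hd0, hd⟩
    · rintro _ ⟨j, rfl⟩
      exact Ideal.subset_span ⟨hginv j, hghom j⟩
  · rw [hilbertIdeal, Ideal.span_le]
    rintro p ⟨hp, d, hd0, hd⟩
    obtain ⟨c, h, hh, hph⟩ := hggen p hp
    set r := C c + ∑ j, h j * g j with hr
    have hrinv : r ∈ invariants G := by
      refine (invariants G).add_mem ((invariants G).algebraMap_mem c) ?_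
      exact (invariants G).sum_mem fun j _ => (invariants G).mul_mem (hh j) (hginv j)
    have hprP : p - r ∈ P := by
      refine mem_span_linForm_of_restrict_eq_zero b hspan hy ?_
      rw [map_sub, hph, sub_self]
    have hc : c = 0 := by
      have h1 := hP0 _ hprP
      have h2 : ∀ j, constantCoeff (g j) = 0 := fun j =>
        let ⟨_, hd, hg⟩ := hghom j
        constantCoeff_eq_zero_of_isHomogeneous hg hd
      simpa [hr, constantCoeff_eq_zero_of_isHomogeneous hd hd0, h2] using h1
    have h1 : p - r ∈ Ideal.span (Set.range f) := by
      rw [hfgen]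
      have hmem : (⟨p - r, (invariants G).sub_mem hp hrinv⟩ : invariants G) ∈
          P.comap (algebraMap ↥(invariants G) (MvPolynomial (Fin n) k)) := hprP
      exact Ideal.mem_map_of_mem _ hmem
    rw [SetLike.mem_coe, ← sub_add_cancel p r]
    refine Ideal.add_mem _ (Ideal.span_mono Set.subset_union_left h1) ?_
    rw [hr, hc, map_zero, zero_add]
    exact Ideal.sum_mem _ fun j _ => Ideal.mul_mem_left _ _
      (Ideal.subset_span (Or.inr ⟨j, rfl⟩))
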